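/- Let H be a connected simple graph, let α ≥ 0, and let σ be a Nash equilibrium of the max-distance network creation game on H such that G = G(σ) is connected. Suppose there exist vertices u, v and real numbers c > 1 and k such that ε_G(v) ≥ c·ε_G(u) + k. Then (c − 1)·δ_G/2 + k ≤ (1 + α)·δ_H (equivalently, when δ_H > 0, δ_G/δ_H ≤ 2·(1 + α − k/δ_H)/(c − 1)). -/

import Mathlib

open scoped ENNReal Classical

namespace NCG

variable {V : Type*}

/-- A strategy profile is valid w.r.t. host graph `H` if each player only buys
edges of `H` incident to it. -/
def Valid (H : SimpleGraph V) (σ : V → Finset V) : Prop :=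
  ∀ v, ∀ w ∈ σ v, H.Adj v w

/-- The graph created by a strategy profile: `u` and `v` are adjacent iff one
of them bought the edge towards the other. -/
def created (σ : V → Finset V) : SimpleGraph V :=
  SimpleGraph.fromRel (fun u v => v ∈ σ u)

/-- Eccentricity of a vertex (`⊤` if the graph is disconnected). -/
noncomputable def ecc (G : SimpleGraph V) (v : V) : ℕ∞ :=
  ⨆ u, G.edist v u

/-- Radius of a graph. -/
noncomputable def radius (G : SimpleGraph V) : ℕ∞ :=
  ⨅ v, ecc G v

/-- The cost of player `v` under strategy profile `σ`, with edge price `α`: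
`α` times the number of bought edges plus the eccentricity of `v` in the
created graph. -/
noncomputable def cost (α : ℝ) (σ : V → Finset V) (v : V) : ℝ≥0∞ :=
  ENNReal.ofReal α * (σ v).card + (ecc (created σ) v : ℝ≥0∞)

/-- Nash equilibrium: no player can strictly decrease its own cost by
unilaterally switching to another valid strategy. -/
def IsNE [DecidableEq V] (H : SimpleGraph V) (α : ℝ) (σ : V → Finset V) : Prop :=
  Valid H σ ∧ ∀ v (s : Finset V), (∀ w ∈ s, H.Adj v w) →
    cost α σ v ≤ cost α (Function.update σ v s) v

/-- Social cost of a strategy profile. -/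
noncomputable def SC [Fintype V] (α : ℝ) (σ : V → Finset V) : ℝ≥0∞ :=
  ∑ v, cost α σ v

end NCG

namespace NCG

/-- Real-valued eccentricity (for connected finite graphs). -/
noncomputable def eccR {V : Type*} (G : SimpleGraph V) (v : V) : ℝ :=
  ((ecc G v : ℝ≥0∞)).toReal

/-- Real-valued diameter (for connected finite graphs). -/
noncomputable def diamR {V : Type*} (G : SimpleGraph V) : ℝ :=
  ((G.ediam : ℝ≥0∞)).toReal

end NCG

namespace NCG

variable {V : Type*}

lemma created_mono {σ τ : V → Finset V} (h : ∀ v, σ v ⊆ τ v) : created σ ≤ created τ := by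
  intro a b hab
  simp only [created, SimpleGraph.fromRel_adj] at hab ⊢
  exact ⟨hab.1, hab.2.imp (fun hb => h a hb) (fun ha => h b ha)⟩

/-- An edge to `y` brings the eccentricity of `x` within one of that of `y`. -/
lemma ecc_le_ecc_add_one {G G' : SimpleGraph V} (hle : G ≤ G') {x y : V} (hxy : G'.Adj x y) :
    ecc G' x ≤ ecc G y + 1 := by
  refine iSup_le fun z => ?_
  calc G'.edist x z ≤ G'.edist x y + G'.edist y z := SimpleGraph.edist_triangle
    _ ≤ 1 + G.edist y z :=
        add_le_add (SimpleGraph.edist_eq_one_iff_adj.2 hxy).le (SimpleGraph.edist_anti hle)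
    _ ≤ 1 + ecc G y := by gcongr; exact SimpleGraph.edist_le_eccent
    _ = ecc G y + 1 := add_comm _ _

/-- At an equilibrium, buying a host edge towards `y` does not pay off. -/
lemma IsNE.ecc_le_of_adj [DecidableEq V] {H : SimpleGraph V} {α : ℝ} {σ : V → Finset V}
    (hNE : IsNE H α σ) {x y : V} (hxy : H.Adj x y) :
    (ecc (created σ) x : ℝ≥0∞) ≤ ecc (created σ) y + (1 + ENNReal.ofReal α) := by
  have hdev := hNE.2 x (insert y (σ x)) fun w hw => by
    rcases Finset.mem_insert.1 hw with rfl | hw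
    · exact hxy
    · exact hNE.1 x w hw
  set τ := Function.update σ x (insert y (σ x)) with hτ
  have hτx : τ x = insert y (σ x) := Function.update_self ..
  have hle : created σ ≤ created τ := created_mono fun v => by
    rcases eq_or_ne v x with rfl | hv
    · rw [hτx]
      exact Finset.subset_insert _ _
    · rw [hτ, Function.update_of_ne hv]
  have hadj : (created τ).Adj x y := by
    simp [created, SimpleGraph.fromRel_adj, hτx, hxy.ne]
  have hecc : (ecc (created τ) x : ℝ≥0∞) ≤ ecc (created σ) y + 1 := by
    exact_mod_cast ENat.toENNReal_le.2 (ecc_le_ecc_add_one hle hadj)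
  have hcard : ((τ x).card : ℝ≥0∞) ≤ (σ x).card + 1 := by
    rw [hτx]
    exact_mod_cast Finset.card_insert_le y (σ x)
  have hfin : ENNReal.ofReal α * (σ x).card ≠ ⊤ :=
    ENNReal.mul_ne_top ENNReal.ofReal_ne_top (ENNReal.natCast_ne_top _)
  refine (ENNReal.add_le_add_iff_left hfin).1 ?_
  calc ENNReal.ofReal α * (σ x).card + (ecc (created σ) x : ℝ≥0∞)
      ≤ ENNReal.ofReal α * (τ x).card + ecc (created τ) x := hdev
    _ ≤ ENNReal.ofReal α * ((σ x).card + 1) + (ecc (created σ) y + 1) := by gcongr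
    _ = ENNReal.ofReal α * (σ x).card + (ecc (created σ) y + (1 + ENNReal.ofReal α)) := by ring

lemma ecc_le_ediam (G : SimpleGraph V) (x : V) : ecc G x ≤ G.ediam :=
  SimpleGraph.eccent_le_ediam

lemma ediam_le_two_mul_ecc (G : SimpleGraph V) (x : V) : G.ediam ≤ 2 * ecc G x :=
  SimpleGraph.ediam_le_two_mul_eccent x

lemma ediam_ne_top [Finite V] {G : SimpleGraph V} (hG : G.Connected) : G.ediam ≠ ⊤ :=
  have := hG.nonempty
  SimpleGraph.connected_iff_ediam_ne_top.1 hG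

lemma ecc_ne_top [Finite V] {G : SimpleGraph V} (hG : G.Connected) (x : V) : ecc G x ≠ ⊤ :=
  ne_top_of_le_ne_top (ediam_ne_top hG) (ecc_le_ediam G x)

lemma diamR_le_two_mul_eccR [Finite V] {G : SimpleGraph V} (hG : G.Connected) (x : V) :
    diamR G ≤ 2 * eccR G x := by
  have hfin : (2 * (ecc G x : ℝ≥0∞)) ≠ ⊤ :=
    ENNReal.mul_ne_top (by simp) (ENat.toENNReal_ne_top.2 (ecc_ne_top hG x))
  have h : (G.ediam : ℝ≥0∞) ≤ 2 * ecc G x := by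
    exact_mod_cast ENat.toENNReal_le.2 (ediam_le_two_mul_ecc G x)
  simpa [diamR, eccR] using ENNReal.toReal_mono hfin h

lemma dist_le_diamR [Finite V] {G : SimpleGraph V} (hG : G.Connected) (x y : V) :
    (G.dist x y : ℝ) ≤ diamR G := by
  have h : ((G.dist x y : ℕ∞) : ℝ≥0∞) ≤ G.ediam := by
    rw [(hG x y).coe_dist_eq_edist]
    exact ENat.toENNReal_le.2 SimpleGraph.edist_le_ediam
  simpa [diamR] using ENNReal.toReal_mono (ENat.toENNReal_ne_top.2 (ediam_ne_top hG)) h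

lemma IsNE.eccR_le_of_adj [Finite V] [DecidableEq V] {H : SimpleGraph V} {α : ℝ}
    {σ : V → Finset V} (hNE : IsNE H α σ) (hα : 0 ≤ α) (hconn : (created σ).Connected)
    {x y : V} (hxy : H.Adj x y) :
    eccR (created σ) x ≤ eccR (created σ) y + (1 + α) := by
  have hy : (ecc (created σ) y : ℝ≥0∞) ≠ ⊤ := ENat.toENNReal_ne_top.2 (ecc_ne_top hconn y)
  have hα' : (1 + ENNReal.ofReal α) ≠ ⊤ := by simp
  have h := ENNReal.toReal_mono (ENNReal.add_ne_top.2 ⟨hy, hα'⟩) (hNE.ecc_le_of_adj hxy)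
  rwa [ENNReal.toReal_add hy hα', ENNReal.toReal_add ENNReal.one_ne_top ENNReal.ofReal_ne_top,
    ENNReal.toReal_one, ENNReal.toReal_ofReal hα] at h

/-- At an equilibrium, eccentricities grow by at most `1 + α` per step in the host graph. -/
lemma IsNE.eccR_le_of_walk [Finite V] [DecidableEq V] {H : SimpleGraph V} {α : ℝ}
    {σ : V → Finset V} (hNE : IsNE H α σ) (hα : 0 ≤ α) (hconn : (created σ).Connected)
    {x y : V} (p : H.Walk x y) :
    eccR (created σ) x ≤ eccR (created σ) y + (1 + α) * p.length := by
  induction p with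
  | nil => simp
  | cons hxy p ih =>
    have h := hNE.eccR_le_of_adj hα hconn hxy
    rw [SimpleGraph.Walk.length_cons]
    push_cast
    linarith

end NCG

/-- At a connected Nash equilibrium, if `ε_G(v) ≥ c·ε_G(u) + k`
with `c > 1`, then `(c − 1)·δ_G/2 + k ≤ (1 + α)·δ_H`. -/
theorem diam_ratio_bound
    {V : Type*} [Fintype V] [DecidableEq V]
    (H : SimpleGraph V) (hH : H.Connected) (α : ℝ) (hα : 0 ≤ α)
    (σ : V → Finset V) (hNE : NCG.IsNE H α σ)
    (hconn : (NCG.created σ).Connected)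
    (u v : V) (c k : ℝ) (hc : 1 < c)
    (huv : c * NCG.eccR (NCG.created σ) u + k ≤ NCG.eccR (NCG.created σ) v) :
    (c - 1) * NCG.diamR (NCG.created σ) / 2 + k ≤ (1 + α) * NCG.diamR H := by
  obtain ⟨p, hp⟩ := hH.exists_walk_length_eq_dist v u
  have hstep := hNE.eccR_le_of_walk hα hconn p
  have hdist : (1 + α) * (p.length : ℝ) ≤ (1 + α) * NCG.diamR H := by
    rw [hp]
    exact mul_le_mul_of_nonneg_left (NCG.dist_le_diamR hH v u) (by linarith)
  have hdiam := mul_le_mul_of_nonneg_left (NCG.diamR_le_two_mul_eccR hconn u)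
    (sub_nonneg.2 hc.le)
  linarith
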